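/- arXiv:1108.3552 — 4 statements merged into one kernel-verified Lean document; each statement's English description precedes it below -/
import Mathlib

section
/- Under the stated hypotheses, for every unit vector u ∈ ℝ^d and every t ∈ ℝ^d, |⟨u, ℓ̇(t) − W + t⟩| ≤ (1/2) · M · G(M|t|) · |t|², where M = max_{i≤n} |w_i|. -/
open scoped RealInnerProductSpace

/-- First-order Taylor bound on `[0, 1]`; the second derivative need not be continuous. -/
theorem abs_sub_sub_le_of_abs_deriv2_le {h h' h'' : ℝ → ℝ} {K : ℝ}
    (hh : ∀ x, HasDerivAt h (h' x) x) (hh' : ∀ x, HasDerivAt h' (h'' x) x)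
    (hK : ∀ x ∈ Set.Icc (0 : ℝ) 1, |h'' x| ≤ K) :
    |h 1 - h 0 - h' 0| ≤ K / 2 := by
  have h1 : ∀ x ∈ Set.Icc (0 : ℝ) 1, |h' x - h' 0| ≤ K * (x - 0) :=
    norm_image_sub_le_of_norm_deriv_le_segment' (fun x _ => (hh' x).hasDerivWithinAt)
      (fun x hx => hK x ⟨hx.1, hx.2.le⟩)
  have hd : ∀ x, HasDerivAt (fun x => h x - h 0 - h' 0 * x) (h' x - h' 0) x := fun x => by
    simpa using ((hh x).sub_const (h 0)).fun_sub ((hasDerivAt_id x).const_mul (h' 0))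
  have hB : ∀ x : ℝ, HasDerivAt (fun x => K / 2 * x ^ 2) (K * x) x := fun x =>
    ((hasDerivAt_pow 2 x).const_mul (K / 2)).congr_deriv (by norm_num; ring)
  have key := image_norm_le_of_norm_deriv_right_le_deriv_boundary
    (fun x _ => (hd x).continuousAt.continuousWithinAt)
    (fun x _ => (hd x).hasDerivWithinAt) (a := 0) (b := 1) (by simp) hB
    (fun x hx => by simpa using h1 x ⟨hx.1, hx.2.le⟩)
    (Set.right_mem_Icc.mpr zero_le_one)
  simpa using key

/-- First-order Taylor bound for a function on the line, in either direction. -/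
theorem abs_taylor_one_le {f : ℝ → ℝ} (hf : Differentiable ℝ f)
    (hf' : Differentiable ℝ (deriv f)) {a s C : ℝ}
    (hC : ∀ r, |r| ≤ |s| → |deriv (deriv f) (a + r)| ≤ C) :
    |f (a + s) - f a - deriv f a * s| ≤ C * s ^ 2 / 2 := by
  have hl : ∀ x : ℝ, HasDerivAt (fun x => a + x * s) s x := fun x => by
    simpa using ((hasDerivAt_id x).mul_const s).const_add a
  have key := abs_sub_sub_le_of_abs_deriv2_le (h := fun x => f (a + x * s))
    (h' := fun x => deriv f (a + x * s) * s)
    (h'' := fun x => deriv (deriv f) (a + x * s) * s * s) (K := C * s ^ 2)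
    (fun x => (hf _).hasDerivAt.comp x (hl x))
    (fun x => ((hf' _).hasDerivAt.comp x (hl x)).mul_const s)
    (fun x hx => by
      have hr : |x * s| ≤ |s| := by
        rw [abs_mul, abs_of_nonneg hx.1]
        exact mul_le_of_le_one_left (abs_nonneg s) hx.2
      rw [mul_assoc, abs_mul, ← sq, abs_of_nonneg (sq_nonneg s)]
      exact mul_le_mul_of_nonneg_right (hC _ hr) (sq_nonneg s))
  simpa using key

/-- Vectors `w i` whose weighted Gram sum is the identity form a weighted Parseval frame. -/
theorem sum_mul_inner_mul_inner_of_isotropic {ι κ : Type*} [Fintype ι] [Fintype κ]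
    [DecidableEq κ] (c : ι → ℝ) (w : ι → EuclideanSpace ℝ κ)
    (hid : ∀ a b : κ, (∑ i, c i * (w i a * w i b)) = if a = b then 1 else 0)
    (u t : EuclideanSpace ℝ κ) :
    ∑ i, c i * (⟪w i, u⟫ * ⟪w i, t⟫) = ⟪u, t⟫ := by
  have hin : ∀ x z : EuclideanSpace ℝ κ, ⟪x, z⟫ = ∑ a, x a * z a := fun x z => by
    simp [PiLp.inner_apply, mul_comm]
  calc ∑ i, c i * (⟪w i, u⟫ * ⟪w i, t⟫)
      = ∑ i, ∑ a, ∑ b, u a * t b * (c i * (w i a * w i b)) := by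
        refine Finset.sum_congr rfl fun i _ => ?_
        rw [hin, hin, Finset.sum_mul_sum, Finset.mul_sum]
        refine Finset.sum_congr rfl fun a _ => ?_
        rw [Finset.mul_sum]
        exact Finset.sum_congr rfl fun b _ => by ring
    _ = ∑ a, ∑ b, u a * t b * ∑ i, c i * (w i a * w i b) := by
        rw [Finset.sum_comm]
        refine Finset.sum_congr rfl fun a _ => ?_
        rw [Finset.sum_comm]
        simp only [Finset.mul_sum]
    _ = ⟪u, t⟫ := by simp [hid, hin]

/-- With `ψ` three times differentiable, `ψ'' > 0`, `G` nondecreasing on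
`[0,∞)`, `|ψ'''(λᵢ + s)| ≤ ψ''(λᵢ) G(|s|)`, and `Σᵢ ψ''(λᵢ) wᵢ wᵢᵀ = I`, the score
`ℓ̇(t) = Σᵢ wᵢ (yᵢ − ψ'(λᵢ + ⟨wᵢ,t⟩))` satisfies, for every unit vector `u` and every `t`,
`|⟨u, ℓ̇(t) − W + t⟩| ≤ (1/2) M G(M‖t‖) ‖t‖²` where `M = maxᵢ ‖wᵢ‖` and
`W = Σᵢ wᵢ (yᵢ − ψ'(λᵢ))`. -/
theorem stmt1 {n d : ℕ} (hn : 0 < n)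
    (ψ : ℝ → ℝ) (G : ℝ → ℝ)
    (hψ1 : Differentiable ℝ ψ) (hψ2 : Differentiable ℝ (deriv ψ))
    (hψ3 : Differentiable ℝ (deriv (deriv ψ)))
    (hψ'' : ∀ x, 0 < deriv (deriv ψ) x)
    (hG : MonotoneOn G (Set.Ici 0)) (hGnonneg : ∀ x, 0 ≤ x → 0 ≤ G x)
    (lam : Fin n → ℝ) (w : Fin n → EuclideanSpace ℝ (Fin d)) (y : Fin n → ℝ)
    (hψ''' : ∀ (i : Fin n) (s : ℝ),
      |deriv (deriv (deriv ψ)) (lam i + s)| ≤ deriv (deriv ψ) (lam i) * G |s|)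
    (hid : ∀ a b : Fin d,
      (∑ i, deriv (deriv ψ) (lam i) * (w i a * w i b)) = if a = b then 1 else 0)
    (W : EuclideanSpace ℝ (Fin d))
    (hW : W = ∑ i, (y i - deriv ψ (lam i)) • w i)
    (score : EuclideanSpace ℝ (Fin d) → EuclideanSpace ℝ (Fin d))
    (hscore : ∀ t, score t = ∑ i, (y i - deriv ψ (lam i + ⟪w i, t⟫)) • w i)
    (M : ℝ)
    (hM : M = Finset.univ.sup'
      (Finset.univ_nonempty_iff.mpr (Fin.pos_iff_nonempty.mp hn)) (fun i => ‖w i‖)) :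
    ∀ (u t : EuclideanSpace ℝ (Fin d)), ‖u‖ = 1 →
      |⟪u, score t - W + t⟫| ≤ (1 / 2) * M * G (M * ‖t‖) * ‖t‖ ^ 2 := by
  intro u t hu
  have hwM : ∀ i, ‖w i‖ ≤ M := fun i => by
    rw [hM]
    exact Finset.le_sup' (fun i => ‖w i‖) (Finset.mem_univ i)
  have hM0 : 0 ≤ M := (norm_nonneg _).trans (hwM ⟨0, hn⟩)
  have hMt : 0 ≤ M * ‖t‖ := mul_nonneg hM0 (norm_nonneg t)
  have hwt : ∀ i, |⟪w i, t⟫| ≤ M * ‖t‖ := fun i =>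
    (abs_real_inner_le_norm _ _).trans
      (mul_le_mul_of_nonneg_right (hwM i) (norm_nonneg t))
  have hwu : ∀ i, |⟪w i, u⟫| ≤ M := fun i => by
    simpa [hu] using (abs_real_inner_le_norm (w i) u).trans
      (mul_le_mul_of_nonneg_right (hwM i) (norm_nonneg u))
  have hR : ∀ i, |deriv ψ (lam i + ⟪w i, t⟫) - deriv ψ (lam i)
      - deriv (deriv ψ) (lam i) * ⟪w i, t⟫|
      ≤ deriv (deriv ψ) (lam i) * G (M * ‖t‖) * ⟪w i, t⟫ ^ 2 / 2 := fun i =>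
    abs_taylor_one_le hψ2 hψ3 fun r hr => (hψ''' i r).trans <|
      mul_le_mul_of_nonneg_left (hG (abs_nonneg r) hMt (hr.trans (hwt i))) (hψ'' _).le
  have frame := sum_mul_inner_mul_inner_of_isotropic
    (fun i => deriv (deriv ψ) (lam i)) w hid
  have expand : ⟪u, score t - W + t⟫ = -∑ i, (deriv ψ (lam i + ⟪w i, t⟫) - deriv ψ (lam i)
      - deriv (deriv ψ) (lam i) * ⟪w i, t⟫) * ⟪w i, u⟫ := by
    rw [inner_add_right, inner_sub_right, hscore, hW, inner_sum, inner_sum, ← frame u t,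
      ← Finset.sum_sub_distrib, ← Finset.sum_add_distrib, ← Finset.sum_neg_distrib]
    refine Finset.sum_congr rfl fun i _ => ?_
    rw [inner_smul_right, inner_smul_right, real_inner_comm (w i) u]
    ring
  rw [expand, abs_neg]
  calc |∑ i, (deriv ψ (lam i + ⟪w i, t⟫) - deriv ψ (lam i)
          - deriv (deriv ψ) (lam i) * ⟪w i, t⟫) * ⟪w i, u⟫|
      ≤ ∑ i, |(deriv ψ (lam i + ⟪w i, t⟫) - deriv ψ (lam i)
          - deriv (deriv ψ) (lam i) * ⟪w i, t⟫) * ⟪w i, u⟫| :=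
        Finset.abs_sum_le_sum_abs _ _
    _ ≤ ∑ i, deriv (deriv ψ) (lam i) * G (M * ‖t‖) * ⟪w i, t⟫ ^ 2 / 2 * M := by
        refine Finset.sum_le_sum fun i _ => ?_
        rw [abs_mul]
        exact mul_le_mul (hR i) (hwu i) (abs_nonneg _) ((abs_nonneg _).trans (hR i))
    _ = (1 / 2) * M * G (M * ‖t‖) *
          ∑ i, deriv (deriv ψ) (lam i) * (⟪w i, t⟫ * ⟪w i, t⟫) := by
        rw [Finset.mul_sum]
        exact Finset.sum_congr rfl fun i _ => by ring
    _ = (1 / 2) * M * G (M * ‖t‖) * ‖t‖ ^ 2 := by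
        rw [frame t t, real_inner_self_eq_norm_sq]
end

section
/- Let ψ : ℝ → ℝ be three times differentiable with ψ'' ≥ 0, let λ, δ ∈ ℝ, and let G : [0,∞) → [0,∞) be nondecreasing such that |ψ'''(λ + t)| ≤ ψ''(λ) G(|t|) for all t with |t| ≤ |δ|. Then ψ(λ) + ψ(λ+δ) − 2ψ(λ + δ/2) ≤ (1/4) δ² ψ''(λ) + (3/16) |δ|³ ψ''(λ) G(|δ|). -/
/-- If `f''' ≤ K` on `[0,1]` then the second difference of `f` at `0, 1/2, 1` is at most
`f''(0)/4 + K/8`. -/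
theorem second_difference_le_of_third_deriv_le {f f₁ f₂ f₃ : ℝ → ℝ} {K : ℝ}
    (h₁ : ∀ s, HasDerivAt f (f₁ s) s) (h₂ : ∀ s, HasDerivAt f₁ (f₂ s) s)
    (h₃ : ∀ s, HasDerivAt f₂ (f₃ s) s) (hK : ∀ s ∈ Set.Icc (0 : ℝ) 1, f₃ s ≤ K) :
    f 0 + f 1 - 2 * f (1 / 2) ≤ f₂ 0 / 4 + K / 8 := by
  have hlin : ∀ s, HasDerivAt (fun s => f₂ s - K * s) (f₃ s - K) s := fun s => by
    exact ((h₃ s).sub ((hasDerivAt_id s).const_mul K)).congr_deriv (by ring)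
  have hanti : AntitoneOn (fun s => f₂ s - K * s) (Set.Icc 0 1) :=
    antitoneOn_of_hasDerivWithinAt_nonpos (convex_Icc 0 1)
      (fun s _ => (hlin s).continuousAt.continuousWithinAt)
      (fun s _ => (hlin s).hasDerivWithinAt)
      (fun s hs => sub_nonpos.2 (hK s (interior_subset hs)))
  have hq : ∀ s, HasDerivAt (fun s => f s - f₂ 0 / 2 * s ^ 2 - K / 6 * s ^ 3)
      (f₁ s - f₂ 0 * s - K / 2 * s ^ 2) s := fun s => by
    refine (((h₁ s).sub ((hasDerivAt_pow 2 s).const_mul (f₂ 0 / 2))).sub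
      ((hasDerivAt_pow 3 s).const_mul (K / 6))).congr_deriv ?_
    norm_num
    ring
  have hq' : ∀ s, HasDerivAt (fun s => f₁ s - f₂ 0 * s - K / 2 * s ^ 2)
      (f₂ s - f₂ 0 - K * s) s := fun s => by
    refine (((h₂ s).sub ((hasDerivAt_id s).const_mul (f₂ 0))).sub
      ((hasDerivAt_pow 2 s).const_mul (K / 2))).congr_deriv ?_
    norm_num
    ring
  have hconc : ConcaveOn ℝ (Set.Icc 0 1) (fun s => f s - f₂ 0 / 2 * s ^ 2 - K / 6 * s ^ 3) := by
    refine concaveOn_of_hasDerivWithinAt2_nonpos (convex_Icc 0 1)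
      (fun s _ => (hq s).continuousAt.continuousWithinAt)
      (fun s _ => (hq s).hasDerivWithinAt) (fun s _ => (hq' s).hasDerivWithinAt) fun s hs => ?_
    have hs' := interior_subset hs
    have h := hanti (Set.left_mem_Icc.2 zero_le_one) hs' hs'.1
    simp only [mul_zero, sub_zero] at h
    linarith
  have h := hconc.2 (Set.left_mem_Icc.2 zero_le_one) (Set.right_mem_Icc.2 zero_le_one)
    (by norm_num : (0 : ℝ) ≤ 1 / 2) (by norm_num : (0 : ℝ) ≤ 1 / 2) (by norm_num)
  norm_num at h ⊢
  linarith


/-- If `ψ` is three times differentiable with `ψ'' ≥ 0`, and `G` is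
nondecreasing on `[0,∞)` with `|ψ'''(λ+t)| ≤ ψ''(λ) G(|t|)` for `|t| ≤ |δ|`, then
`ψ(λ) + ψ(λ+δ) − 2ψ(λ+δ/2) ≤ (1/4) δ² ψ''(λ) + (3/16) |δ|³ ψ''(λ) G(|δ|)`. -/
theorem stmt6 (ψ : ℝ → ℝ) (G : ℝ → ℝ) (lam δ : ℝ)
    (hψ1 : Differentiable ℝ ψ) (hψ2 : Differentiable ℝ (deriv ψ))
    (hψ3 : Differentiable ℝ (deriv (deriv ψ)))
    (hψ'' : ∀ x, 0 ≤ deriv (deriv ψ) x)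
    (hG : MonotoneOn G (Set.Ici 0)) (hGnonneg : ∀ x, 0 ≤ x → 0 ≤ G x)
    (hψ''' : ∀ t : ℝ, |t| ≤ |δ| →
      |deriv (deriv (deriv ψ)) (lam + t)| ≤ deriv (deriv ψ) lam * G |t|) :
    ψ lam + ψ (lam + δ) - 2 * ψ (lam + δ / 2) ≤
      (1 / 4) * δ ^ 2 * deriv (deriv ψ) lam +
        (3 / 16) * |δ| ^ 3 * deriv (deriv ψ) lam * G |δ| := by
  have hline : ∀ s, HasDerivAt (fun s : ℝ => lam + s * δ) δ s := fun s => by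
    simpa using ((hasDerivAt_id s).mul_const δ).const_add lam
  have hM : 0 ≤ deriv (deriv ψ) lam * G |δ| :=
    mul_nonneg (hψ'' lam) (hGnonneg _ (abs_nonneg δ))
  have hbound : ∀ s ∈ Set.Icc (0 : ℝ) 1,
      deriv (deriv (deriv ψ)) (lam + s * δ) * δ * δ ^ 2 ≤
        |δ| ^ 3 * (deriv (deriv ψ) lam * G |δ|) := fun s hs => by
    have hsδ : |s * δ| ≤ |δ| := by
      rw [abs_mul, abs_of_nonneg hs.1]
      exact mul_le_of_le_one_left (abs_nonneg δ) hs.2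
    have hthird : |deriv (deriv (deriv ψ)) (lam + s * δ)| ≤ deriv (deriv ψ) lam * G |δ| :=
      (hψ''' _ hsδ).trans <| mul_le_mul_of_nonneg_left
        (hG (abs_nonneg (s * δ)) (abs_nonneg δ) hsδ) (hψ'' lam)
    calc deriv (deriv (deriv ψ)) (lam + s * δ) * δ * δ ^ 2
        ≤ |deriv (deriv (deriv ψ)) (lam + s * δ) * δ * δ ^ 2| := le_abs_self _
      _ = |δ| ^ 3 * |deriv (deriv (deriv ψ)) (lam + s * δ)| := by
        rw [abs_mul, abs_mul, abs_pow]
        ring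
      _ ≤ |δ| ^ 3 * (deriv (deriv ψ) lam * G |δ|) := by gcongr
  have h := second_difference_le_of_third_deriv_le
    (f := fun s => ψ (lam + s * δ)) (f₁ := fun s => deriv ψ (lam + s * δ) * δ)
    (f₂ := fun s => deriv (deriv ψ) (lam + s * δ) * δ ^ 2)
    (fun s => (hψ1 _).hasDerivAt.comp s (hline s))
    (fun s => (((hψ2 _).hasDerivAt.comp s (hline s)).mul_const δ).congr_deriv (by ring))
    (fun s => ((hψ3 _).hasDerivAt.comp s (hline s)).mul_const (δ ^ 2)) hbound
  have hmid : lam + 1 / 2 * δ = lam + δ / 2 := by ring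
  simp only [zero_mul, add_zero, one_mul, hmid] at h
  have hK : 0 ≤ |δ| ^ 3 * (deriv (deriv ψ) lam * G |δ|) := by positivity
  linarith
end

section
/- Let η be a standard normal random variable and let h : ℝ → [0, ∞) be measurable with E[(1 + η²) h(η)] < ∞, and suppose there is c₀ > 0 with h(x) ≥ c₀ for all |x| ≤ 1. Define r_j = E[η^j h(η)] for j = 0, 1, 2. Then √(2π) · r₀ ≥ c₀ ∫_{−1}^{1} e^{−x²/2} dx > 0 and √(2π) · (r₀r₂ − r₁²) ≥ c₀ r₀ ∫_{−1}^{1} x² e^{−x²/2} dx > 0. -/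
open MeasureTheory ProbabilityTheory Real

/-- A function that dominates `c * g` on `[-1, 1]` has Gaussian expectation at least the
corresponding truncated Gaussian integral of `c * g`. -/
theorem intervalIntegral_mul_exp_le_integral_gaussianReal {c : ℝ} (hc : 0 ≤ c) {f g : ℝ → ℝ}
    (hg : ∀ x, 0 ≤ g x) (hf : ∀ x, 0 ≤ f x) (hfg : ∀ x, |x| ≤ 1 → c * g x ≤ f x)
    (hint : Integrable f (gaussianReal 0 1)) :
    c * ∫ x in (-1 : ℝ)..1, g x * exp (-x ^ 2 / 2) ≤
      Real.sqrt (2 * π) * ∫ x, f x ∂gaussianReal 0 1 := by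
  have hle : ∫ x, (Set.Ioc (-1 : ℝ) 1).indicator (fun x => c * g x) x ∂gaussianReal 0 1 ≤
      ∫ x, f x ∂gaussianReal 0 1 := by
    refine integral_mono_of_nonneg (.of_forall fun x => ?_) hint (.of_forall fun x => ?_)
    · exact Set.indicator_nonneg (fun y _ => mul_nonneg hc (hg y)) x
    · exact Set.indicator_le' (fun y hy => hfg y (abs_le.2 ⟨hy.1.le, hy.2⟩)) (fun y _ => hf y) x
  have heq : Real.sqrt (2 * π) *
      ∫ x, (Set.Ioc (-1 : ℝ) 1).indicator (fun x => c * g x) x ∂gaussianReal 0 1 =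
      c * ∫ x in (-1 : ℝ)..1, g x * exp (-x ^ 2 / 2) := by
    rw [integral_gaussianReal_eq_integral_smul one_ne_zero,
      intervalIntegral.integral_of_le (by norm_num), ← integral_indicator measurableSet_Ioc,
      ← integral_const_mul, ← integral_const_mul]
    refine integral_congr_ae (.of_forall fun x => ?_)
    have hpi : Real.sqrt (2 * π) ≠ 0 := by positivity
    by_cases hx : x ∈ Set.Ioc (-1 : ℝ) 1
    · simp only [Set.indicator_of_mem hx, gaussianPDFReal, smul_eq_mul, NNReal.coe_one, mul_one,
        sub_zero]
      field_simp
    · simp [Set.indicator_of_notMem hx]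
  rw [← heq]
  gcongr

/-- The second moment about any point of the truncated Gaussian weight is at least the one about
its centre. -/
theorem intervalIntegral_sq_mul_exp_le_sub_sq (m : ℝ) :
    ∫ x in (-1 : ℝ)..1, x ^ 2 * exp (-x ^ 2 / 2) ≤
      ∫ x in (-1 : ℝ)..1, (x - m) ^ 2 * exp (-x ^ 2 / 2) := by
  have hodd : ∫ x in (-1 : ℝ)..1, x * exp (-x ^ 2 / 2) = 0 := by
    have hneg := intervalIntegral.integral_comp_neg (a := -1) (b := 1)
      (fun x : ℝ => x * exp (-x ^ 2 / 2))
    simp only [neg_sq, neg_mul, intervalIntegral.integral_neg, neg_neg] at hneg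
    linarith
  have hexpand : ∫ x in (-1 : ℝ)..1, (x - m) ^ 2 * exp (-x ^ 2 / 2) =
      (∫ x in (-1 : ℝ)..1, x ^ 2 * exp (-x ^ 2 / 2)) -
        2 * m * (∫ x in (-1 : ℝ)..1, x * exp (-x ^ 2 / 2)) +
        m ^ 2 * ∫ x in (-1 : ℝ)..1, exp (-x ^ 2 / 2) := by
    rw [← intervalIntegral.integral_const_mul, ← intervalIntegral.integral_const_mul,
      ← intervalIntegral.integral_sub, ← intervalIntegral.integral_add]
    · congr 1 with x
      ring
    all_goals exact Continuous.intervalIntegrable (by fun_prop) _ _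
  have hnn : 0 ≤ ∫ x in (-1 : ℝ)..1, exp (-x ^ 2 / 2) :=
    intervalIntegral.integral_nonneg (by norm_num) fun x _ => (exp_pos _).le
  rw [hexpand, hodd]
  nlinarith [mul_nonneg (sq_nonneg m) hnn]

/-- For a standard normal `η` and a measurable `h ≥ 0` with
`E[(1+η²)h(η)] < ∞` and `h ≥ c₀ > 0` on `[−1,1]`, setting `r_j = E[η^j h(η)]`, one has
`√(2π) r₀ ≥ c₀ ∫_{−1}^1 e^{−x²/2} dx > 0` and
`√(2π)(r₀r₂ − r₁²) ≥ c₀ r₀ ∫_{−1}^1 x² e^{−x²/2} dx > 0`. -/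
theorem stmt15 {Ω : Type*} [MeasurableSpace Ω] (P : Measure Ω) [IsProbabilityMeasure P]
    (η : Ω → ℝ) (hmeas : Measurable η) (hgauss : P.map η = gaussianReal 0 1)
    (h : ℝ → ℝ) (hhmeas : Measurable h) (hhnonneg : ∀ x, 0 ≤ h x)
    (c₀ : ℝ) (hc₀ : 0 < c₀) (hlower : ∀ x : ℝ, |x| ≤ 1 → c₀ ≤ h x)
    (hint : Integrable (fun ω => (1 + (η ω) ^ 2) * h (η ω)) P)
    (r : ℕ → ℝ) (hr : ∀ j, r j = ∫ ω, (η ω) ^ j * h (η ω) ∂P) :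
    (0 < c₀ * ∫ x in (-1 : ℝ)..1, exp (-x ^ 2 / 2)) ∧
    (c₀ * ∫ x in (-1 : ℝ)..1, exp (-x ^ 2 / 2)) ≤ Real.sqrt (2 * π) * r 0 ∧
    (0 < c₀ * r 0 * ∫ x in (-1 : ℝ)..1, x ^ 2 * exp (-x ^ 2 / 2)) ∧
    (c₀ * r 0 * ∫ x in (-1 : ℝ)..1, x ^ 2 * exp (-x ^ 2 / 2)) ≤
      Real.sqrt (2 * π) * (r 0 * r 2 - (r 1) ^ 2) := by
  have hr' (j : ℕ) : r j = ∫ x, x ^ j * h x ∂gaussianReal 0 1 := by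
    rw [hr, ← hgauss, integral_map hmeas.aemeasurable
      (by fun_prop : Measurable fun x : ℝ => x ^ j * h x).aestronglyMeasurable]
  have hdom : Integrable (fun x => (1 + x ^ 2) * h x) (gaussianReal 0 1) := by
    rw [← hgauss, integrable_map_measure (by fun_prop) hmeas.aemeasurable]
    exact hint
  have hmom (j : ℕ) (hj : ∀ x : ℝ, |x ^ j| ≤ 1 + x ^ 2) :
      Integrable (fun x => x ^ j * h x) (gaussianReal 0 1) := by
    refine hdom.mono' (by fun_prop) (.of_forall fun x => ?_)
    rw [norm_mul, Real.norm_eq_abs, Real.norm_of_nonneg (hhnonneg x)]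
    exact mul_le_mul_of_nonneg_right (hj x) (hhnonneg x)
  have h0 := hmom 0 fun x => by simp [sq_nonneg]
  have h1 := hmom 1 fun x => abs_le.2 ⟨by nlinarith [sq_nonneg (x + 1)],
    by nlinarith [sq_nonneg (x - 1)]⟩
  have h2 := hmom 2 fun x => by simp
  have hpos0 : 0 < ∫ x in (-1 : ℝ)..1, exp (-x ^ 2 / 2) :=
    intervalIntegral.intervalIntegral_pos_of_pos
      (Continuous.intervalIntegrable (by fun_prop) _ _) (fun x => exp_pos _) (by norm_num)
  have hpos2 : 0 < ∫ x in (-1 : ℝ)..1, x ^ 2 * exp (-x ^ 2 / 2) :=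
    intervalIntegral.integral_pos (by norm_num) (by fun_prop) (fun x _ => by positivity)
      ⟨1, by norm_num, by positivity⟩
  have hle0 : (c₀ * ∫ x in (-1 : ℝ)..1, exp (-x ^ 2 / 2)) ≤ Real.sqrt (2 * π) * r 0 := by
    simpa [hr'] using intervalIntegral_mul_exp_le_integral_gaussianReal hc₀.le
      (g := fun _ => 1) (f := h) (fun _ => zero_le_one) hhnonneg (by simpa using hlower)
      (by simpa using h0)
  have hr0 : 0 < r 0 :=
    pos_of_mul_pos_right ((mul_pos hc₀ hpos0).trans_le hle0) (Real.sqrt_nonneg _)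
  refine ⟨mul_pos hc₀ hpos0, hle0, by positivity, ?_⟩
  set m := r 1 / r 0 with hm
  have hexp : (fun x => (x - m) ^ 2 * h x) =
      fun x => x ^ 2 * h x - 2 * m * (x ^ 1 * h x) + m ^ 2 * (x ^ 0 * h x) := by
    ext x
    ring
  have hsub : Integrable (fun x => x ^ 2 * h x - 2 * m * (x ^ 1 * h x)) (gaussianReal 0 1) :=
    h2.sub (h1.const_mul _)
  have hcentred : Integrable (fun x => (x - m) ^ 2 * h x) (gaussianReal 0 1) := by
    rw [hexp]
    exact hsub.add (h0.const_mul _)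
  have hvar : r 0 * ∫ x, (x - m) ^ 2 * h x ∂gaussianReal 0 1 = r 0 * r 2 - r 1 ^ 2 := by
    rw [hexp, integral_add hsub (h0.const_mul _),
      integral_sub h2 (h1.const_mul _), integral_const_mul, integral_const_mul, ← hr', ← hr',
      ← hr', hm]
    field_simp
    ring
  have hle2 := intervalIntegral_mul_exp_le_integral_gaussianReal hc₀.le
    (g := fun x => (x - m) ^ 2) (f := fun x => (x - m) ^ 2 * h x) (fun x => sq_nonneg _)
    (fun x => mul_nonneg (sq_nonneg _) (hhnonneg x))
    (fun x hx => by nlinarith [mul_le_mul_of_nonneg_left (hlower x hx) (sq_nonneg (x - m))])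
    hcentred
  have hle := (mul_le_mul_of_nonneg_left (intervalIntegral_sq_mul_exp_le_sub_sq m) hc₀.le).trans
    hle2
  rw [← hvar]
  nlinarith [mul_le_mul_of_nonneg_left hle hr0.le]
end

section
/- Let H be a separable Hilbert space, let T : H → H be a compact self-adjoint operator with orthonormal eigenbasis (φ_j)_{j∈ℕ} and corresponding real eigenvalues (θ_j)_{j∈ℕ}, and let Δ : H → H be self-adjoint with T̃ = T + Δ compact. Fix k and set ε_k = inf_{j ≠ k} |θ_j − θ_k|; assume ε_k > 5‖Δ‖, where ‖Δ‖ is the operator norm. Let θ̃_k be an eigenvalue of T̃ with |θ̃_k − θ_k| ≤ ‖Δ‖ and let φ̃_k be a corresponding unit eigenvector, and let σ_k ∈ {−1, +1} be such that σ_k⟨φ̃_k, φ_k⟩ ≥ 0. Define Λ_k = Σ_{j ≠ k} ( ⟨φ_j, Δφ_k⟩ / (θ_k − θ_j) ) φ_j ∈ H. Then ‖σ_k φ̃_k − φ_k‖ ≤ 3‖Λ_k‖. -/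
open scoped RealInnerProductSpace

/-- Coefficientwise domination in a Hilbert basis implies domination in norm. -/
theorem HilbertBasis.norm_le_mul_of_abs_inner_le {ι H : Type*} [NormedAddCommGroup H]
    [InnerProductSpace ℝ H] (b : HilbertBasis ι ℝ H) {x y : H} {C : ℝ} (hC : 0 ≤ C)
    (h : ∀ i, |⟪b i, x⟫| ≤ C * |⟪b i, y⟫|) : ‖x‖ ≤ C * ‖y‖ := by
  have hx := b.hasSum_inner_mul_inner x x
  have hy := (b.hasSum_inner_mul_inner y y).mul_left (C ^ 2)
  have hle : ⟪x, x⟫ ≤ C ^ 2 * ⟪y, y⟫ := by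
    refine hasSum_le (fun i => ?_) hx hy
    rw [real_inner_comm, real_inner_comm (b i) y]
    have := pow_le_pow_left₀ (abs_nonneg _) (h i) 2
    rw [mul_pow, sq_abs, sq_abs] at this
    linarith
  rw [real_inner_self_eq_norm_sq, real_inner_self_eq_norm_sq, ← mul_pow] at hle
  exact le_of_sq_le_sq hle (by positivity)

/-- A family of coefficients dominated by those of a vector sums to a vector with these
coefficients. -/
theorem HilbertBasis.inner_tsum_of_abs_le {ι H : Type*} [NormedAddCommGroup H]
    [InnerProductSpace ℝ H] (b : HilbertBasis ι ℝ H) {c : ι → ℝ} {y : H} {C : ℝ}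
    (h : ∀ i, |c i| ≤ C * |⟪b i, y⟫|) (i : ι) : ⟪b i, ∑' j, c j • b j⟫ = c i := by
  have hc : Memℓp c 2 := by
    refine memℓp_gen ?_
    have hy := (b.hasSum_inner_mul_inner y y).summable.mul_left (C ^ 2)
    refine Summable.of_nonneg_of_le (fun i => by positivity) (fun i => ?_) hy
    have := pow_le_pow_left₀ (abs_nonneg _) (h i) 2
    rw [mul_pow, sq_abs, sq_abs] at this
    rw [real_inner_comm (b i) y]
    simp only [Real.norm_eq_abs, ENNReal.toReal_ofNat, Real.rpow_ofNat, sq_abs]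
    linarith
  have hs := b.hasSum_repr_symm ⟨c, hc⟩
  have he : ∑' j, c j • b j = b.repr.symm ⟨c, hc⟩ := hs.tsum_eq
  rw [he, ← b.repr_apply_apply, LinearIsometryEquiv.apply_symm_apply]

/-- If a unit vector `u` has nonnegative component along the unit vector `e`, then its distance to
`e` is at most `√2` times the norm of its component orthogonal to `e`. -/
theorem norm_sub_sq_le_two_mul_norm_sub_inner_smul_sq {H : Type*} [NormedAddCommGroup H]
    [InnerProductSpace ℝ H] {u e : H} (hu : ‖u‖ = 1) (he : ‖e‖ = 1) (h : 0 ≤ ⟪u, e⟫) :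
    ‖u - e‖ ^ 2 ≤ 2 * ‖u - ⟪u, e⟫ • e‖ ^ 2 := by
  have hle : ⟪u, e⟫ ≤ 1 := by simpa [hu, he] using real_inner_le_norm u e
  rw [norm_sub_sq_real, norm_sub_sq_real, norm_smul, inner_smul_right, mul_pow, hu, he,
    Real.norm_eq_abs, sq_abs]
  nlinarith

/-- Perturbation bound for eigenvectors of a compact self-adjoint operator
`T` on a separable Hilbert space with orthonormal eigenbasis `(φ_j)` and eigenvalues
`(θ_j)`.  If `Δ` is self-adjoint, `T̃ = T + Δ` is compact, `ε_k = inf_{j≠k} |θ_j − θ_k|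
> 5‖Δ‖`, `θ̃_k` is an eigenvalue of `T̃` with `|θ̃_k − θ_k| ≤ ‖Δ‖` with unit eigenvector
`φ̃_k`, and `σ_k ∈ {±1}` is such that `σ_k ⟨φ̃_k, φ_k⟩ ≥ 0`, then
`‖σ_k φ̃_k − φ_k‖ ≤ 3 ‖Λ_k‖` where `Λ_k = Σ_{j≠k} (⟨φ_j, Δφ_k⟩/(θ_k − θ_j)) φ_j`. -/
theorem stmt17 {H : Type*} [NormedAddCommGroup H] [InnerProductSpace ℝ H]
    [CompleteSpace H] [TopologicalSpace.SeparableSpace H]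
    (T Δ : H →L[ℝ] H)
    (hTsa : IsSelfAdjoint T) (hTcompact : IsCompactOperator T)
    (hΔsa : IsSelfAdjoint Δ) (hTΔcompact : IsCompactOperator (T + Δ))
    (φ : ℕ → H) (θ : ℕ → ℝ) (hON : Orthonormal ℝ φ)
    (hcomplete : (Submodule.span ℝ (Set.range φ)).topologicalClosure = ⊤)
    (heig : ∀ j, T (φ j) = θ j • φ j)
    (k : ℕ) (εk : ℝ) (hεk : εk = ⨅ j : {j : ℕ // j ≠ k}, |θ (j : ℕ) - θ k|)
    (hgap : 5 * ‖Δ‖ < εk)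
    (θt : ℝ) (φt : H) (heigt : (T + Δ) φt = θt • φt) (hunit : ‖φt‖ = 1)
    (hclose : |θt - θ k| ≤ ‖Δ‖)
    (σ : ℝ) (hσ : σ = 1 ∨ σ = -1) (hsign : 0 ≤ σ * ⟪φt, φ k⟫)
    (Λ : H)
    (hΛ : Λ = ∑' j : ℕ, if j ≠ k then (⟪φ j, Δ (φ k)⟫ / (θ k - θ j)) • φ j else 0) :
    ‖σ • φt - φ k‖ ≤ 3 * ‖Λ‖ := by
  set b : HilbertBasis ℕ ℝ H := HilbertBasis.mk hON hcomplete.ge with hb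
  have hbφ : ∀ j, b j = φ j := fun j => by simp [hb]
  have hε0 : 0 < εk := lt_of_le_of_lt (by positivity) hgap
  have hgapj : ∀ j, j ≠ k → εk ≤ |θ k - θ j| := fun j hj => by
    rw [hεk, abs_sub_comm]
    exact ciInf_le (f := fun j : {j : ℕ // j ≠ k} => |θ (j : ℕ) - θ k|)
      ⟨0, by rintro _ ⟨j, rfl⟩; positivity⟩ ⟨j, hj⟩
  have hdiv : ∀ j, j ≠ k → ∀ t : ℝ, |t / (θ k - θ j)| ≤ εk⁻¹ * |t| := fun j hj t => by
    rw [abs_div, div_eq_inv_mul]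
    gcongr
    exact hgapj j hj
  have hΛcoef : ∀ j, ⟪φ j, Λ⟫ = if j ≠ k then ⟪φ j, Δ (φ k)⟫ / (θ k - θ j) else 0 := fun j => by
    have := b.inner_tsum_of_abs_le (y := Δ (φ k)) (C := εk⁻¹)
      (c := fun j => if j ≠ k then ⟪φ j, Δ (φ k)⟫ / (θ k - θ j) else 0) (fun i => by
        rw [hbφ]
        split_ifs with hi
        · exact hdiv i hi _
        · rw [abs_zero]; positivity) j
    simpa only [hbφ, ite_smul, zero_smul, ← hΛ] using this
  set u := σ • φt with hu_def
  have hu : ‖u‖ = 1 := by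
    rcases hσ with rfl | rfl <;> simp [hu_def, hunit]
  have heigu : T u + Δ u = θt • u := by
    rw [hu_def, smul_comm θt, ← heigt]
    simp
  have hc0 : 0 ≤ ⟪u, φ k⟫ := by rwa [hu_def, real_inner_smul_left]
  clear_value u
  have hφk : ‖φ k‖ = 1 := hON.1 k
  have hc1 : ⟪u, φ k⟫ ≤ 1 := by simpa [hu, hφk] using real_inner_le_norm u (φ k)
  have hdist := norm_sub_sq_le_two_mul_norm_sub_inner_smul_sq hu hφk hc0
  have hck : ⟪φ k, u⟫ = ⟪u, φ k⟫ := real_inner_comm _ _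
  set c := ⟪u, φ k⟫
  set w := u - c • φ k with hw
  have huw : u = c • φ k + w := by rw [hw]; abel
  set z := Δ w + (θ k - θt) • w with hz
  have hzn : ‖z‖ ≤ 2 * ‖Δ‖ * ‖w‖ := by
    have h1 := norm_add_le (Δ w) ((θ k - θt) • w)
    have h2 := Δ.le_opNorm w
    rw [norm_smul, Real.norm_eq_abs, abs_sub_comm] at h1
    nlinarith [mul_le_mul_of_nonneg_right hclose (norm_nonneg w)]
  have hres : ‖w - c • Λ‖ ≤ εk⁻¹ * ‖z‖ := by
    refine b.norm_le_mul_of_abs_inner_le (by positivity) fun j => ?_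
    rw [hbφ, inner_sub_right, inner_smul_right, hΛcoef]
    by_cases hj : j = k
    · subst hj
      have : ⟪φ j, w⟫ = 0 := by
        rw [hw, inner_sub_right, inner_smul_right, real_inner_self_eq_norm_sq, hφk, hck]
        ring
      simp only [this, ne_eq, not_true_eq_false, if_false, mul_zero, sub_zero, abs_zero]
      positivity
    · have hjk : ⟪φ j, φ k⟫ = 0 := hON.2 hj
      have hjw : ⟪φ j, u⟫ = ⟪φ j, w⟫ := by
        rw [hw, inner_sub_right, inner_smul_right, hjk]; ring
      have hne : θ k - θ j ≠ 0 := abs_pos.1 (hε0.trans_le (hgapj j hj))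
      have hTu : ⟪φ j, T u⟫ = θ j * ⟪φ j, w⟫ := by
        rw [← hjw, ← real_inner_smul_left, ← heig]
        exact (hTsa.isSymmetric (φ j) u).symm
      have hΔu : ⟪φ j, Δ u⟫ = c * ⟪φ j, Δ (φ k)⟫ + ⟪φ j, Δ w⟫ := by
        rw [huw, map_add, map_smul, inner_add_right, inner_smul_right]
      have hkey := congrArg (fun v => ⟪φ j, v⟫) heigu
      simp only [inner_add_right, inner_smul_right] at hkey
      rw [hTu, hΔu, hjw] at hkey
      rw [if_pos hj]
      have : ⟪φ j, w⟫ - c * (⟪φ j, Δ (φ k)⟫ / (θ k - θ j)) = ⟪φ j, z⟫ / (θ k - θ j) := by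
        rw [hz, inner_add_right, inner_smul_right]
        field_simp
        linarith
      rw [this]
      exact hdiv j hj _
  have hwΛ : 3 * ‖w‖ ≤ 5 * ‖Λ‖ := by
    have h1 : ‖w - c • Λ‖ ≤ 2 / 5 * ‖w‖ := by
      refine hres.trans ?_
      rw [inv_mul_le_iff₀ hε0]
      nlinarith [mul_le_mul_of_nonneg_right hgap.le (norm_nonneg w)]
    have h2 : ‖w‖ ≤ ‖w - c • Λ‖ + ‖c • Λ‖ := by
      simpa using norm_add_le (w - c • Λ) (c • Λ)
    rw [norm_smul, Real.norm_of_nonneg hc0] at h2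
    nlinarith [mul_le_mul_of_nonneg_right hc1 (norm_nonneg Λ)]
  refine le_of_sq_le_sq ?_ (by positivity)
  nlinarith [norm_nonneg w, norm_nonneg Λ]
end
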